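/- arXiv:2101.07658 — 9 statements merged into one kernel-verified Lean document; each statement's English description precedes it below -/
import Mathlib

section
/- Let R be a commutative ring in which 2 and 3 are invertible. Then: (i) χ(λ·b) = λ·χ(b) for every λ ∈ R and b ∈ R⁴, where λ·(p₂,p₆,p₈,p₁₂) = (λ²p₂, λ⁶p₆, λ⁸p₈, λ¹²p₁₂); (ii) χ : R⁴ → R⁴ is a bijection, with two-sided inverse given by b ↦ 18⁻¹·χ(b), i.e. χ(18⁻¹·χ(b)) = b and 18⁻¹·χ(χ(b)) = b for all b ∈ R⁴. -/
/-- The bigonal-construction map `χ : R⁴ → R⁴` on the parameters `(p₂, p₆, p₈, p₁₂)`. -/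
def chi {R : Type*} [CommRing R] (b : R × R × R × R) : R × R × R × R :=
  (-18 * b.1,
   5832 * b.2.1 - 486 * b.1 ^ 3,
   104976 * b.2.2.1 - 2187 * b.1 ^ 4 + 52488 * b.1 * b.2.1,
   -34012224 * b.2.2.2 - 39366 * b.1 ^ 6 + 1417176 * b.1 ^ 3 * b.2.1
     - 8503056 * b.2.1 ^ 2 + 2834352 * b.1 ^ 2 * b.2.2.1)

/-- The weighted scaling `λ · (p₂, p₆, p₈, p₁₂) = (λ²p₂, λ⁶p₆, λ⁸p₈, λ¹²p₁₂)`. -/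
def wsmul {R : Type*} [CommRing R] (lam : R) (b : R × R × R × R) : R × R × R × R :=
  (lam ^ 2 * b.1, lam ^ 6 * b.2.1, lam ^ 8 * b.2.2.1, lam ^ 12 * b.2.2.2)

/-- The map `χ` is equivariant for the weighted scaling. -/
theorem chi_wsmul {R : Type*} [CommRing R] (lam : R) (b : R × R × R × R) :
    chi (wsmul lam b) = wsmul lam (chi b) := by
  simp only [chi, wsmul, Prod.mk.injEq]
  refine ⟨?_, ?_, ?_, ?_⟩ <;> ring

/-- Applying `χ` twice is the weighted scaling by `18`. -/
theorem chi_chi {R : Type*} [CommRing R] (b : R × R × R × R) :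
    chi (chi b) = wsmul 18 b := by
  simp only [chi, wsmul, Prod.mk.injEq]
  refine ⟨?_, ?_, ?_, ?_⟩ <;> ring

theorem wsmul_wsmul {R : Type*} [CommRing R] (s t : R) (b : R × R × R × R) :
    wsmul s (wsmul t b) = wsmul (s * t) b := by
  simp only [wsmul, mul_pow, mul_assoc]

theorem one_wsmul {R : Type*} [CommRing R] (b : R × R × R × R) : wsmul 1 b = b := by
  simp [wsmul]

/-- If `2` and `3` are invertible in the commutative ring `R`, then:
(i) `χ(λ·b) = λ·χ(b)` for the weighted scaling; (ii) `χ : R⁴ → R⁴` is a bijection,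
with two-sided inverse given by `b ↦ 18⁻¹·χ(b)`, i.e. for any `u` with `18u = 1`,
`χ(u·χ(b)) = b` and `u·χ(χ(b)) = b` for all `b`. -/
theorem chi_equivariant_and_bijective {R : Type*} [CommRing R]
    (h2 : IsUnit (2 : R)) (h3 : IsUnit (3 : R)) :
    (∀ (lam : R) (b : R × R × R × R), chi (wsmul lam b) = wsmul lam (chi b)) ∧
    Function.Bijective (chi (R := R)) ∧
    (∀ u : R, (18 : R) * u = 1 →
      ∀ b : R × R × R × R, chi (wsmul u (chi b)) = b ∧ wsmul u (chi (chi b)) = b) := by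
  have left_inv (u : R) (hu : (18 : R) * u = 1) (b : R × R × R × R) :
      wsmul u (chi (chi b)) = b := by
    rw [chi_chi, wsmul_wsmul, mul_comm, hu, one_wsmul]
  have right_inv (u : R) (hu : (18 : R) * u = 1) (b : R × R × R × R) :
      chi (wsmul u (chi b)) = b := by
    rw [chi_wsmul, left_inv u hu]
  have h18 : IsUnit (18 : R) := by
    convert h2.mul (h3.mul h3) using 1
    norm_num
  obtain ⟨u, hu⟩ := h18.exists_right_inv
  exact ⟨chi_wsmul, Function.bijective_iff_has_inverse.mpr
    ⟨fun b => wsmul u (chi b), left_inv u hu, right_inv u hu⟩,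
    fun v hv b => ⟨right_inv v hv b, left_inv v hv b⟩⟩
end

section
/- Let R be a commutative ring and p₂, p₆, p₈, p₁₂ ∈ R. Write (q₂, q₆, q₈, q₁₂) = χ(p₂, p₆, p₈, p₁₂). Let Δ be the discriminant of the Weierstrass curve with coefficients (a₁, a₂, a₃, a₄, a₆) = (p₂, 0, p₆, p₈, p₁₂), i.e. Δ = −b₂²b₈ − 8b₄³ − 27b₆² + 9b₂b₄b₆ where b₂ = a₁² + 4a₂, b₄ = 2a₄ + a₁a₃, b₆ = a₃² + 4a₆, b₈ = a₁²a₆ + 4a₂a₆ − a₁a₃a₄ + a₂a₃² − a₄². Then 4·q₈³ + 27·q₁₂² = −2⁸·3²⁴·Δ. -/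
/-- The discriminant of the Weierstrass curve with coefficients `(a₁, a₂, a₃, a₄, a₆)`:
`Δ = −b₂²b₈ − 8b₄³ − 27b₆² + 9b₂b₄b₆` where `b₂ = a₁² + 4a₂`, `b₄ = 2a₄ + a₁a₃`,
`b₆ = a₃² + 4a₆`, `b₈ = a₁²a₆ + 4a₂a₆ − a₁a₃a₄ + a₂a₃² − a₄²`. -/
def weierstrassDisc {R : Type*} [CommRing R] (a1 a2 a3 a4 a6 : R) : R :=
  -(a1 ^ 2 + 4 * a2) ^ 2 *
      (a1 ^ 2 * a6 + 4 * a2 * a6 - a1 * a3 * a4 + a2 * a3 ^ 2 - a4 ^ 2)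
    - 8 * (2 * a4 + a1 * a3) ^ 3 - 27 * (a3 ^ 2 + 4 * a6) ^ 2
    + 9 * (a1 ^ 2 + 4 * a2) * (2 * a4 + a1 * a3) * (a3 ^ 2 + 4 * a6)

/-- Writing `(q₂, q₆, q₈, q₁₂) = χ(p₂, p₆, p₈, p₁₂)` and letting `Δ` be the discriminant of the
Weierstrass curve `y² + p₂xy + p₆y = x³ + p₈x + p₁₂`, one has
`4q₈³ + 27q₁₂² = −2⁸·3²⁴·Δ`. -/
theorem bigonal_discriminant_identity {R : Type*} [CommRing R] (p2 p6 p8 p12 : R) :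
    4 * (chi (p2, p6, p8, p12)).2.2.1 ^ 3 + 27 * (chi (p2, p6, p8, p12)).2.2.2 ^ 2 =
      -(2 ^ 8 * 3 ^ 24 : R) * weierstrassDisc p2 0 p6 p8 p12 := by
  simp only [chi, weierstrassDisc]
  ring
end

section
/- Let R be a commutative ring and let p₂, p₆, p₈, p₁₂, x, y, y' ∈ R satisfy y⁴ + p₂xy² + p₆y² = x³ + p₈x + p₁₂ and y² + y'² + p₂x + p₆ = 0. Then: (a) y'⁴ + p₂xy'² + p₆y'² = x³ + p₈x + p₁₂; (b) (y + y')² + p₂x + p₆ = 2yy'; (c) ((y + y')² + p₂x + p₆)² = −4·(x³ + p₈x + p₁₂). -/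
/-- The algebraic identities underlying the bigonal construction: if `(x, y)` lies on the
genus-3 curve `y⁴ + p₂xy² + p₆y² = x³ + p₈x + p₁₂` and `y' ` satisfies
`y² + y'² + p₂x + p₆ = 0`, then (a) `(x, y')` also lies on the curve,
(b) `(y + y')² + p₂x + p₆ = 2yy'`, and (c) `((y + y')² + p₂x + p₆)² = −4(x³ + p₈x + p₁₂)`. -/
theorem bigonal_point_identities {R : Type*} [CommRing R]
    (p2 p6 p8 p12 x y y' : R)
    (h1 : y ^ 4 + p2 * x * y ^ 2 + p6 * y ^ 2 = x ^ 3 + p8 * x + p12)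
    (h2 : y ^ 2 + y' ^ 2 + p2 * x + p6 = 0) :
    (y' ^ 4 + p2 * x * y' ^ 2 + p6 * y' ^ 2 = x ^ 3 + p8 * x + p12) ∧
    ((y + y') ^ 2 + p2 * x + p6 = 2 * (y * y')) ∧
    (((y + y') ^ 2 + p2 * x + p6) ^ 2 = -4 * (x ^ 3 + p8 * x + p12)) := by
  refine ⟨?_, ?_, ?_⟩
  · linear_combination h1 + (y' ^ 2 - y ^ 2) * h2
  · linear_combination h2
  · linear_combination
      (y ^ 2 + y' ^ 2 + p2 * x + p6 + 4 * y * y' + 4 * y ^ 2) * h2 - 4 * h1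
end

section
/- Let k be an algebraically closed field of characteristic different from 2, and let p₂, p₆, p₈, p₁₂ ∈ k. Then the following are equivalent: (1) there exists (x, y) ∈ k² with y⁴ + p₂xy² + p₆y² = x³ + p₈x + p₁₂, 4y³ + 2p₂xy + 2p₆y = 0, and p₂y² − 3x² − p₈ = 0; (2) either there exists (x, Y) ∈ k² with Y² + p₂xY + p₆Y = x³ + p₈x + p₁₂, 2Y + p₂x + p₆ = 0, and p₂Y − 3x² − p₈ = 0, or there exists x ∈ k with x³ + p₈x + p₁₂ = 0 and 3x² + p₈ = 0. -/
/-- Over an algebraically closed field of characteristic different from 2, the affine quartic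
curve `y⁴ + p₂xy² + p₆y² = x³ + p₈x + p₁₂` has a singular point if and only if either the
affine Weierstrass curve `Y² + p₂xY + p₆Y = x³ + p₈x + p₁₂` has a singular point or the cubic
`x³ + p₈x + p₁₂` has a repeated root. -/
theorem quartic_singular_iff_weierstrass_or_cubic {k : Type*} [Field k] [IsAlgClosed k]
    (hchar : (2 : k) ≠ 0) (p2 p6 p8 p12 : k) :
    (∃ x y : k,
        y ^ 4 + p2 * x * y ^ 2 + p6 * y ^ 2 = x ^ 3 + p8 * x + p12 ∧
        4 * y ^ 3 + 2 * p2 * x * y + 2 * p6 * y = 0 ∧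
        p2 * y ^ 2 - 3 * x ^ 2 - p8 = 0) ↔
    ((∃ x Y : k,
        Y ^ 2 + p2 * x * Y + p6 * Y = x ^ 3 + p8 * x + p12 ∧
        2 * Y + p2 * x + p6 = 0 ∧
        p2 * Y - 3 * x ^ 2 - p8 = 0) ∨
      (∃ x : k, x ^ 3 + p8 * x + p12 = 0 ∧ 3 * x ^ 2 + p8 = 0)) := by
  constructor
  · rintro ⟨x, y, hF, hy, hx⟩
    have hfactor : 2 * y * (2 * y ^ 2 + p2 * x + p6) = 0 := by linear_combination hy
    rcases mul_eq_zero.mp hfactor with h | h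
    · obtain rfl : y = 0 := (mul_eq_zero.mp h).resolve_left hchar
      exact Or.inr ⟨x, by linear_combination -hF, by linear_combination -hx⟩
    · exact Or.inl ⟨x, y ^ 2, by linear_combination hF, h, hx⟩
  · rintro (⟨x, Y, hF, hY, hx⟩ | ⟨x, hF, hx⟩)
    · obtain ⟨y, rfl⟩ := IsAlgClosed.exists_pow_nat_eq Y two_pos
      exact ⟨x, y, by linear_combination hF, by linear_combination 2 * y * hY, hx⟩
    · exact ⟨x, 0, by linear_combination -hF, by ring, by linear_combination -hx⟩
end

section
/- Let 0 → A →f B →g C → 0 be a short exact sequence of abelian groups with compatible involutions τ_A, τ_B, τ_C, and assume that every element of A fixed by τ_A lies in (1+τ_A)A, i.e. A^{τ_A} = (1+τ_A)A. Then 0 → A[1+τ_A] → B[1+τ_B] → C[1+τ_C] → 0 is a short exact sequence; in particular, every c ∈ C with c + τ_C(c) = 0 is of the form c = g(b) for some b ∈ B with b + τ_B(b) = 0. -/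
/-- Case (1) of the lemma on exact sequences with involution: if `0 → A → B → C → 0` is a
short exact sequence of abelian groups with compatible involutions, and every `τ_A`-fixed
element of `A` lies in `(1+τ_A)A`, then `0 → A[1+τ_A] → B[1+τ_B] → C[1+τ_C] → 0` is a
short exact sequence; in particular every `c ∈ C` with `c + τ_C(c) = 0` is of the form
`c = g(b)` for some `b ∈ B` with `b + τ_B(b) = 0`. -/
theorem exact_sequence_with_involution_of_norm_surjective
    {A B C : Type*} [AddCommGroup A] [AddCommGroup B] [AddCommGroup C]
    (f : A →+ B) (g : B →+ C) (τA : A →+ A) (τB : B →+ B) (τC : C →+ C)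
    (hf : Function.Injective f) (hg : Function.Surjective g)
    (hexact : ∀ b : B, g b = 0 ↔ ∃ a : A, f a = b)
    (hτA : ∀ a, τA (τA a) = a) (hτB : ∀ b, τB (τB b) = b) (hτC : ∀ c, τC (τC c) = c)
    (hfτ : ∀ a, f (τA a) = τB (f a)) (hgτ : ∀ b, g (τB b) = τC (g b))
    (hnorm : ∀ a : A, τA a = a → ∃ a₀ : A, a = a₀ + τA a₀) :
    -- `f` maps `A[1+τ_A]` into `B[1+τ_B]`
    (∀ a : A, a + τA a = 0 → f a + τB (f a) = 0) ∧
    -- `g` maps `B[1+τ_B]` into `C[1+τ_C]`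
    (∀ b : B, b + τB b = 0 → g b + τC (g b) = 0) ∧
    -- `f` restricted to `A[1+τ_A]` is injective
    (∀ a a' : A, a + τA a = 0 → a' + τA a' = 0 → f a = f a' → a = a') ∧
    -- exactness at `B[1+τ_B]`
    (∀ b : B, b + τB b = 0 → (g b = 0 ↔ ∃ a : A, a + τA a = 0 ∧ f a = b)) ∧
    -- `g` restricted to `B[1+τ_B]` is surjective onto `C[1+τ_C]`
    (∀ c : C, c + τC c = 0 → ∃ b : B, b + τB b = 0 ∧ g b = c) := by
  refine ⟨fun a ha => ?_, fun b hb => ?_, fun a a' _ _ h => hf h, fun b hb => ⟨fun h => ?_, ?_⟩,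
    fun c hc => ?_⟩
  · rw [← hfτ, ← map_add, ha, map_zero]
  · rw [← hgτ, ← map_add, hb, map_zero]
  · obtain ⟨a, rfl⟩ := (hexact b).1 h
    refine ⟨a, hf ?_, rfl⟩
    rw [map_add, hfτ, hb, map_zero]
  · rintro ⟨a, -, rfl⟩
    exact (hexact _).2 ⟨a, rfl⟩
  · obtain ⟨b, rfl⟩ := hg c
    obtain ⟨a, ha⟩ := (hexact (b + τB b)).1 (by rw [map_add, hgτ, hc])
    have a_fixed : τA a = a := hf (by rw [hfτ, ha, map_add, hτB, add_comm])
    obtain ⟨a₀, rfl⟩ := hnorm a a_fixed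
    rw [map_add, hfτ] at ha
    refine ⟨b - f a₀, ?_, ?_⟩
    · rw [map_sub, sub_add_sub_comm, ha, sub_self]
    · rw [map_sub, (hexact (f a₀)).2 ⟨a₀, rfl⟩, sub_zero]
end

section
/- Let k ≥ 1, let Φ be a finite set, let n : Φ → ℝᵏ, and let P ∈ ℝᵏ. Suppose M₀'' ⊆ M₀' ⊆ Φ, that M₁' ⊆ Φ ∖ M₀' and f' : M₁' → ℝ with f'(β) ≥ 0 for all β witness that M₀' is good (i.e. Σ_{β∈M₁'} f'(β) < #M₀' and for every coordinate i, Pᵢ − Σ_{α∈M₀'} nᵢ(α) + Σ_{β∈M₁'} f'(β)·nᵢ(β) > 0), and that there exists a function g : M₀' ∖ M₀'' → M₁' with nᵢ(α) ≥ nᵢ(g(α)) for every coordinate i and every α ∈ M₀' ∖ M₀'', and f'(β) ≥ #g⁻¹(β) for every β ∈ M₁'. Then every subset M₀ with M₀'' ⊆ M₀ ⊆ M₀' is good. -/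
open Finset

/-- A subset `M₀ ⊆ Φ` is good (with respect to the weight function `n : Φ → ℝᵏ` and the
vector `P ∈ ℝᵏ`) if there exist `M₁ ⊆ Φ ∖ M₀` and `f : M₁ → ℝ≥0` with
`Σ_{β∈M₁} f(β) < #M₀` and `Pᵢ − Σ_{α∈M₀} nᵢ(α) + Σ_{β∈M₁} f(β)·nᵢ(β) > 0` for all `i`. -/
def IsGood {ι : Type*} [DecidableEq ι] {k : ℕ} (Φ : Finset ι)
    (n : ι → Fin k → ℝ) (P : Fin k → ℝ) (M₀ : Finset ι) : Prop :=
  ∃ M₁ : Finset ι, M₁ ⊆ Φ \ M₀ ∧ ∃ f : ι → ℝ,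
    (∀ β ∈ M₁, 0 ≤ f β) ∧
    (∑ β ∈ M₁, f β) < (M₀.card : ℝ) ∧
    ∀ i : Fin k, 0 < P i - (∑ α ∈ M₀, n α i) + ∑ β ∈ M₁, f β * n β i

/-- Summing a function of `g α` over `S` amounts to summing over the values of `g`, weighted by
the sizes of its fibres. -/
theorem sum_card_fiber_mul {ι κ : Type*} [DecidableEq κ] {S : Finset ι} {T : Finset κ}
    {g : ι → κ} (hg : ∀ α ∈ S, g α ∈ T) (h : κ → ℝ) :
    ∑ β ∈ T, (#{α ∈ S | g α = β} : ℝ) * h β = ∑ α ∈ S, h (g α) := by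
  simp only [← sum_fiberwise_of_maps_to' hg, sum_const, nsmul_eq_mul]

/-- Propagation of goodness certificates: if `(M₁', f')` witnesses that `M₀'` is good, and
`g : M₀' ∖ M₀'' → M₁'` satisfies `nᵢ(α) ≥ nᵢ(g(α))` coordinatewise and
`f'(β) ≥ #g⁻¹(β)` for all `β ∈ M₁'`, then every `M₀` with `M₀'' ⊆ M₀ ⊆ M₀'` is good. -/
theorem good_of_sandwiched {ι : Type*} [DecidableEq ι] {k : ℕ} (Φ : Finset ι)
    (n : ι → Fin k → ℝ) (P : Fin k → ℝ)
    (M₀'' M₀' M₁' : Finset ι) (f' : ι → ℝ) (g : ι → ι)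
    (hsub1 : M₀'' ⊆ M₀') (hsub2 : M₀' ⊆ Φ)
    (hM₁' : M₁' ⊆ Φ \ M₀')
    (hf'nonneg : ∀ β ∈ M₁', 0 ≤ f' β)
    (hf'sum : (∑ β ∈ M₁', f' β) < (M₀'.card : ℝ))
    (hf'pos : ∀ i : Fin k, 0 < P i - (∑ α ∈ M₀', n α i) + ∑ β ∈ M₁', f' β * n β i)
    (hg : ∀ α ∈ M₀' \ M₀'', g α ∈ M₁')
    (hgle : ∀ α ∈ M₀' \ M₀'', ∀ i : Fin k, n (g α) i ≤ n α i)
    (hgcount : ∀ β ∈ M₁', (((M₀' \ M₀'').filter (fun α => g α = β)).card : ℝ) ≤ f' β) :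
    ∀ M₀ : Finset ι, M₀'' ⊆ M₀ → M₀ ⊆ M₀' → IsGood Φ n P M₀ := by
  intro M₀ h₁ h₂
  have hS : M₀' \ M₀ ⊆ M₀' \ M₀'' := sdiff_subset_sdiff Subset.rfl h₁
  have hgS : ∀ α ∈ M₀' \ M₀, g α ∈ M₁' := fun α hα => hg α (hS hα)
  refine ⟨M₁', hM₁'.trans (sdiff_subset_sdiff Subset.rfl h₂),
    fun β => f' β - #{α ∈ M₀' \ M₀ | g α = β}, fun β hβ => ?_, ?_, fun i => ?_⟩
  · have hcard : (#{α ∈ M₀' \ M₀ | g α = β} : ℝ) ≤ #{α ∈ M₀' \ M₀'' | g α = β} := by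
      exact_mod_cast card_le_card (filter_subset_filter _ hS)
    exact sub_nonneg.2 (hcard.trans (hgcount β hβ))
  · have hfib := sum_card_fiber_mul hgS fun _ => 1
    simp only [mul_one, sum_const, nsmul_eq_mul] at hfib
    have hcard : (#(M₀' \ M₀) : ℝ) + #M₀ = #M₀' := by
      exact_mod_cast card_sdiff_add_card_eq_card h₂
    rw [sum_sub_distrib, hfib]
    linarith
  · have hfib := sum_card_fiber_mul hgS fun β => n β i
    have hle : ∑ α ∈ M₀' \ M₀, n (g α) i ≤ ∑ α ∈ M₀' \ M₀, n α i :=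
      sum_le_sum fun α hα => hgle α (hS hα) i
    have hsplit := sum_sdiff (f := fun α => n α i) h₂
    simp only [sub_mul, sum_sub_distrib]
    linarith [hf'pos i]
end

section
/- Let m : {1, …, 28} → ℤ⁴ be given by m(1)=(2,4,3,1), m(2)=(2,4,1,1), m(3)=(2,2,1,1), m(4)=(2,4,3,−1), m(5)=(0,2,1,1), m(6)=(2,0,1,1), m(7)=(2,4,1,−1), m(8)=(2,2,1,−1), m(9)=(0,0,1,1), m(10)=(2,0,−1,1), m(11)=(0,2,1,−1), m(12)=(0,0,−1,1), m(13)=(2,0,1,−1), m(14)=(−2,0,1,1), m(15)=(2,0,−1,−1), m(16)=(−2,0,−1,1), m(17)=(0,0,1,−1), m(18)=(0,−2,−1,1), m(19)=(−2,0,1,−1), m(20)=(0,0,−1,−1), m(21)=(−2,−2,−1,1), m(22)=(−2,−4,−1,1), m(23)=(−2,0,−1,−1), m(24)=(0,−2,−1,−1), m(25)=(−2,−4,−3,1), m(26)=(−2,−2,−1,−1), m(27)=(−2,−4,−1,−1), m(28)=(−2,−4,−3,−1), and let P = (12, 20, 12, 2). Let M₀ be a nonempty subset of {1,2,3,4,5,6,7,8,9,10,13}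 such that not both 9 ∈ M₀ and 10 ∈ M₀, and such that M₀ is upward closed: for all a ∈ M₀ and b ∈ {1,…,28}, if every coordinate of m(b) − m(a) is ≥ 0 then b ∈ M₀. Then there exist a subset M₁ ⊆ {1,…,28} ∖ M₀ and a function f : M₁ → ℝ with f(β) ≥ 0 for all β, Σ_{β∈M₁} f(β) < #M₀, and for every coordinate i ∈ {1,2,3,4}: Pᵢ − Σ_{α∈M₀} mᵢ(α) + Σ_{β∈M₁} f(β)·mᵢ(β) > 0. -/
open Finset

/-- The coordinates (in the basis `{β₁/2, β₂/2, β₃/2, β₄/2}`) of the 28 weights of the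
group of type `C₃×A₁` acting on the 28-dimensional representation `V` arising from the
stable ℤ/2ℤ-grading of the Lie algebra of type `F₄`. -/
def mwt : ℕ → Fin 4 → ℤ
  | 1 => ![2, 4, 3, 1]
  | 2 => ![2, 4, 1, 1]
  | 3 => ![2, 2, 1, 1]
  | 4 => ![2, 4, 3, -1]
  | 5 => ![0, 2, 1, 1]
  | 6 => ![2, 0, 1, 1]
  | 7 => ![2, 4, 1, -1]
  | 8 => ![2, 2, 1, -1]
  | 9 => ![0, 0, 1, 1]
  | 10 => ![2, 0, -1, 1]
  | 11 => ![0, 2, 1, -1]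
  | 12 => ![0, 0, -1, 1]
  | 13 => ![2, 0, 1, -1]
  | 14 => ![-2, 0, 1, 1]
  | 15 => ![2, 0, -1, -1]
  | 16 => ![-2, 0, -1, 1]
  | 17 => ![0, 0, 1, -1]
  | 18 => ![0, -2, -1, 1]
  | 19 => ![-2, 0, 1, -1]
  | 20 => ![0, 0, -1, -1]
  | 21 => ![-2, -2, -1, 1]
  | 22 => ![-2, -4, -1, 1]
  | 23 => ![-2, 0, -1, -1]
  | 24 => ![0, -2, -1, -1]
  | 25 => ![-2, -4, -3, 1]
  | 26 => ![-2, -2, -1, -1]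
  | 27 => ![-2, -4, -1, -1]
  | 28 => ![-2, -4, -3, -1]
  | _ => ![0, 0, 0, 0]

/-- Twice the sum of the coordinates of the positive roots of `C₃×A₁` in the basis
`{β₁, β₂, β₃, β₄}`. -/
def Pvec : Fin 4 → ℤ := ![12, 20, 12, 2]

/-- The `i`-th coordinate of `P - ∑ α ∈ M, m(α)`. -/
def cuspDefect (M : Finset ℕ) (i : Fin 4) : ℤ := Pvec i - ∑ α ∈ M, mwt α i

/-- Eight times a certificate for `M` when `9 ∉ M`, supported on the weights `9`, `11`, `15`. The
weights `15` and `11` repair the first two coordinates, and `9` then repairs the last two. -/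
def certWithoutNine (M : Finset ℕ) : ℕ → ℕ :=
  let a := (1 - 4 * cuspDefect M 0).toNat
  let b := (1 - 4 * cuspDefect M 1).toNat
  let c := max (1 + a - b - 8 * cuspDefect M 2).toNat (1 + a + b - 8 * cuspDefect M 3).toNat
  fun β ↦ if β = 15 then a else if β = 11 then b else if β = 9 then c else 0

/-- Eight times a certificate for `M` when `9 ∈ M`, supported on the weights `10`, `11`, `14`, `17`.
The weight `14` repairs the sum of the last two coordinates, `10` and `11` repair the first two, and
`17` balances the last two. -/
def certWithNine (M : Finset ℕ) : ℕ → ℕ :=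
  let t := (1 - 4 * (cuspDefect M 2 + cuspDefect M 3)).toNat
  let b := (1 - 4 * cuspDefect M 1).toNat
  let a := max (1 + t - 4 * cuspDefect M 0).toNat (1 + b - t - 8 * cuspDefect M 3).toNat
  let d := (1 + a - b - t - 8 * cuspDefect M 2).toNat
  fun β ↦ if β = 14 then t else if β = 11 then b else if β = 10 then a else if β = 17 then d else 0

/-- Eight times a certificate for `M`. -/
def cuspCert (M : Finset ℕ) : ℕ → ℕ :=
  if 9 ∈ M then certWithNine M else certWithoutNine M

/-- The weights on which the certificates are supported. -/
def cuspSupport : Finset ℕ := {9, 10, 11, 14, 15, 17}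

/-- The subsets of `l` that are closed under passing from `x` to any later entry `y` of `l` such that
`r x y`. -/
def closedSubsets {α : Type*} [DecidableEq α] (r : α → α → Prop) [DecidableRel r] :
    List α → List (Finset α)
  | [] => [∅]
  | x :: l => closedSubsets r l ++
      ((closedSubsets r l).filter fun s ↦ ∀ y ∈ l, r x y → y ∈ s).map (insert x)

theorem filter_mem_closedSubsets {α : Type*} [DecidableEq α] {r : α → α → Prop} [DecidableRel r]
    {M : Finset α} : ∀ {l : List α}, (∀ x ∈ M, ∀ y ∈ l, r x y → y ∈ M) →
      l.toFinset.filter (· ∈ M) ∈ closedSubsets r l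
  | [], _ => by simp [closedSubsets]
  | x :: l, h => by
    have ih := filter_mem_closedSubsets (r := r) (M := M) (l := l)
      fun a ha y hy ↦ h a ha y (List.mem_cons_of_mem x hy)
    rw [closedSubsets, List.mem_append, List.toFinset_cons, filter_insert]
    split_ifs with hx
    · refine .inr (List.mem_map_of_mem (List.mem_filter.2 ⟨ih, decide_eq_true fun y hy hxy ↦ ?_⟩))
      exact mem_filter.2 ⟨List.mem_toFinset.2 hy, h x hx y (List.mem_cons_of_mem x hy) hxy⟩
    · exact .inl ih

theorem cuspCert_spec :
    ∀ M ∈ closedSubsets (fun a b ↦ ∀ i, mwt a i ≤ mwt b i) [13, 10, 9, 8, 7, 6, 5, 4, 3, 2, 1],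
      M.Nonempty → ¬(9 ∈ M ∧ 10 ∈ M) →
        ∑ β ∈ cuspSupport \ M, cuspCert M β < 8 * M.card ∧
          ∀ i, 0 < 8 * cuspDefect M i + ∑ β ∈ cuspSupport \ M, cuspCert M β * mwt β i := by
  decide +kernel

/-- The combinatorial proposition cutting off the cuspidal region: any nonempty upward-closed
subset `M₀ ⊆ {1,…,10,13}` not containing both `9` and `10` admits a goodness certificate
`(M₁, f)`. -/
theorem cusp_cutoff_certificate (M₀ : Finset ℕ) (hne : M₀.Nonempty)
    (hsub : M₀ ⊆ ({1, 2, 3, 4, 5, 6, 7, 8, 9, 10, 13} : Finset ℕ))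
    (h910 : ¬(9 ∈ M₀ ∧ 10 ∈ M₀))
    (hup : ∀ a ∈ M₀, ∀ b : ℕ, 1 ≤ b → b ≤ 28 →
      (∀ i : Fin 4, mwt a i ≤ mwt b i) → b ∈ M₀) :
    ∃ M₁ : Finset ℕ, M₁ ⊆ Finset.Icc 1 28 \ M₀ ∧ ∃ f : ℕ → ℝ,
      (∀ β ∈ M₁, 0 ≤ f β) ∧
      (∑ β ∈ M₁, f β) < (M₀.card : ℝ) ∧
      ∀ i : Fin 4, 0 < (Pvec i : ℝ) - (∑ α ∈ M₀, (mwt α i : ℝ))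
        + ∑ β ∈ M₁, f β * (mwt β i : ℝ) := by
  have hM : M₀ ∈ closedSubsets (fun a b ↦ ∀ i, mwt a i ≤ mwt b i)
      [13, 10, 9, 8, 7, 6, 5, 4, 3, 2, 1] := by
    have hl : ∀ b ∈ [13, 10, 9, 8, 7, 6, 5, 4, 3, 2, 1], 1 ≤ b ∧ b ≤ 28 := by decide
    convert filter_mem_closedSubsets fun a ha b hb hab ↦
      hup a ha b (hl b hb).1 (hl b hb).2 hab using 1
    ext x
    have := @hsub x
    simp only [mem_insert, mem_singleton, mem_filter, List.mem_toFinset, List.mem_cons,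
      List.not_mem_nil] at this ⊢
    tauto
  obtain ⟨hsum, hpos⟩ := cuspCert_spec M₀ hM hne h910
  refine ⟨cuspSupport \ M₀, sdiff_subset_sdiff (by decide) Subset.rfl,
    fun β ↦ cuspCert M₀ β / 8, fun β _ ↦ by positivity, ?_, fun i ↦ ?_⟩
  · rw [← sum_div, div_lt_iff₀' (by norm_num)]
    exact_mod_cast hsum
  · have h : (0 : ℝ) < 8 * ((Pvec i : ℝ) - ∑ α ∈ M₀, (mwt α i : ℝ))
        + ∑ β ∈ cuspSupport \ M₀, (cuspCert M₀ β : ℝ) * (mwt β i : ℝ) := by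
      exact_mod_cast hpos i
    simp only [div_mul_eq_mul_div, ← sum_div]
    linarith
end

section
/- Let Λ, B, s₁, …, s₆, W, ζ, W^ζ be as in the E₆ setup. Then the 𝔽₂-subspaces of Λ/2Λ ≅ 𝔽₂⁶ that are stable under the mod-2 reduction w̄ of every w ∈ W^ζ are exactly the four subspaces 0 ⊆ (1+ζ̄)(Λ/2Λ) ⊆ ker(1+ζ̄ : Λ/2Λ → Λ/2Λ) ⊆ Λ/2Λ, which have 𝔽₂-dimensions 0, 2, 4 and 6 respectively. -/
/-- The Cartan matrix of type `E₆` in Bourbaki numbering. -/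
def E6Cartan : Matrix (Fin 6) (Fin 6) ℤ :=
  !![2, 0, -1, 0, 0, 0;
     0, 2, 0, -1, 0, 0;
     -1, 0, 2, -1, 0, 0;
     0, -1, -1, 2, -1, 0;
     0, 0, 0, -1, 2, -1;
     0, 0, 0, 0, -1, 2]

/-- The symmetric bilinear form on the `E₆` root lattice `Λ = ℤ⁶` determined by the
Cartan matrix: `B(αᵢ, αⱼ) = Cᵢⱼ` on the standard basis. -/
def E6Form (v w : Fin 6 → ℤ) : ℤ := ∑ i, ∑ j, v i * E6Cartan i j * w j

/-- The simple reflection `sᵢ(v) = v − B(v, αᵢ)·αᵢ`. -/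
def E6refl (i : Fin 6) : Function.End (Fin 6 → ℤ) :=
  fun v => v - E6Form v (Pi.single i 1) • Pi.single i 1

/-- The Weyl group `W` of type `E₆`, realised as the submonoid of endomorphisms of `Λ`
generated by the simple reflections `s₁, …, s₆` (each reflection is an involution, so this
is the subgroup they generate). -/
def E6Weyl : Submonoid (Function.End (Fin 6 → ℤ)) :=
  Submonoid.closure (Set.range E6refl)

/-- The diagram automorphism on indices (0-indexed): `α₁↔α₆`, `α₃↔α₅`, fixing `α₂, α₄`. -/
def E6zetaPerm : Fin 6 → Fin 6 := ![5, 1, 4, 3, 2, 0]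

/-- The diagram involution `ζ` of `Λ`, sending `αᵢ ↦ α_{σ(i)}`. -/
def E6zeta : Function.End (Fin 6 → ℤ) := fun v j => v (E6zetaPerm j)

/-- Reduction modulo `2`, `Λ → Λ/2Λ ≅ 𝔽₂⁶`. -/
def red2 (v : Fin 6 → ℤ) : Fin 6 → ZMod 2 := fun i => (v i : ZMod 2)

/-- The map `ζ̄` induced by `ζ` on `Λ/2Λ ≅ 𝔽₂⁶`. -/
def zetaBar : (Fin 6 → ZMod 2) →ₗ[ZMod 2] (Fin 6 → ZMod 2) where
  toFun x := fun j => x (E6zetaPerm j)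
  map_add' := fun _ _ => rfl
  map_smul' := fun _ _ => rfl

/-- The linear map `1 + ζ̄` on `Λ/2Λ`. -/
def onePlusZetaBar : (Fin 6 → ZMod 2) →ₗ[ZMod 2] (Fin 6 → ZMod 2) :=
  LinearMap.id + zetaBar

/-- The simple root `αᵢ` modulo `2`. -/
abbrev rootBar (i : Fin 6) : Fin 6 → ZMod 2 := Pi.single i 1

/-- The reflection `sᵢ` modulo `2`. -/
def reflBar (i : Fin 6) : (Fin 6 → ZMod 2) →ₗ[ZMod 2] (Fin 6 → ZMod 2) where
  toFun x := x - (∑ k, x k * (E6Cartan k i : ZMod 2)) • rootBar i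
  map_add' x y := by
    simp only [Pi.add_apply, add_mul, Finset.sum_add_distrib, add_smul]
    abel
  map_smul' c x := by
    simp only [Pi.smul_apply, smul_eq_mul, mul_assoc, ← Finset.mul_sum, mul_smul, smul_sub,
      RingHom.id_apply]

theorem reflBar_apply (i : Fin 6) (x : Fin 6 → ZMod 2) :
    reflBar i x = x - (∑ k, x k * (E6Cartan k i : ZMod 2)) • rootBar i := rfl

theorem red2_surjective : Function.Surjective red2 := fun x =>
  ⟨fun i => ((x i).val : ℤ), funext fun i => by simp [red2]⟩

theorem E6Form_single (v : Fin 6 → ℤ) (i : Fin 6) :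
    E6Form v (Pi.single i 1) = ∑ k, v k * E6Cartan k i := by
  simp [E6Form, Pi.single_apply]

theorem E6refl_apply (i : Fin 6) (v : Fin 6 → ℤ) :
    E6refl i v = v - (∑ k, v k * E6Cartan k i) • Pi.single i 1 := by
  rw [← E6Form_single]
  rfl

theorem red2_E6refl (i : Fin 6) (v : Fin 6 → ℤ) :
    red2 (E6refl i v) = reflBar i (red2 v) := by
  ext j
  simp [E6refl_apply, reflBar_apply, red2, Pi.single_apply]

theorem red2_E6zeta (v : Fin 6 → ℤ) : red2 (E6zeta v) = zetaBar (red2 v) := rfl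

theorem E6refl_mem (i : Fin 6) : E6refl i ∈ E6Weyl :=
  Submonoid.subset_closure ⟨i, rfl⟩

theorem E6refl_mul_E6zeta (i : Fin 6) :
    E6refl i * E6zeta = E6zeta * E6refl (E6zetaPerm i) := by
  funext v
  change E6refl i (E6zeta v) = E6zeta (E6refl (E6zetaPerm i) v)
  ext j
  fin_cases i <;> fin_cases j <;>
    simp [E6refl_apply, E6zeta, E6zetaPerm, E6Cartan, Fin.sum_univ_six] <;> ring

theorem E6refl_mul_comm {i j : Fin 6} (h : E6Cartan i j = 0) (h' : E6Cartan j i = 0) :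
    E6refl i * E6refl j = E6refl j * E6refl i := by
  funext v
  change E6refl i (E6refl j v) = E6refl j (E6refl i v)
  simp only [E6refl_apply, Pi.sub_apply, Pi.smul_apply, sub_mul, Finset.sum_sub_distrib,
    Pi.single_apply, smul_eq_mul, mul_ite, ite_mul, mul_one, mul_zero, zero_mul,
    Finset.sum_ite_eq', Finset.mem_univ, if_true, h, h', sub_zero]
  abel

/-- A product `sᵢ s_{ζ(i)}` over an orbit of size two of commuting reflections lies in `W^ζ`. -/
theorem E6refl_mul_commute_E6zeta {i : Fin 6} (hi : E6zetaPerm (E6zetaPerm i) = i)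
    (hc : E6refl i * E6refl (E6zetaPerm i) = E6refl (E6zetaPerm i) * E6refl i) :
    E6refl i * E6refl (E6zetaPerm i) * E6zeta =
      E6zeta * (E6refl i * E6refl (E6zetaPerm i)) := by
  rw [mul_assoc, E6refl_mul_E6zeta, hi, ← mul_assoc, E6refl_mul_E6zeta, mul_assoc, hc]

/-- Every Weyl group element induces a linear map modulo `2`. -/
theorem exists_linearMap_red2 {w : Function.End (Fin 6 → ℤ)} (hw : w ∈ E6Weyl) :
    ∃ f : (Fin 6 → ZMod 2) →ₗ[ZMod 2] (Fin 6 → ZMod 2), ∀ v, red2 (w v) = f (red2 v) := by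
  induction hw using Submonoid.closure_induction with
  | mem x hx =>
    obtain ⟨i, rfl⟩ := hx
    exact ⟨reflBar i, red2_E6refl i⟩
  | one => exact ⟨LinearMap.id, fun _ => rfl⟩
  | mul x y _ _ hx hy =>
    obtain ⟨f, hf⟩ := hx
    obtain ⟨g, hg⟩ := hy
    exact ⟨f ∘ₗ g, fun v => (hf (y v)).trans (congrArg f (hg v))⟩

/-- Elements of `W^ζ` induce linear maps commuting with `1 + ζ̄`. -/
theorem exists_linearMap_commute {w : Function.End (Fin 6 → ℤ)} (hw : w ∈ E6Weyl)
    (hz : w * E6zeta = E6zeta * w) :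
    ∃ f : (Fin 6 → ZMod 2) →ₗ[ZMod 2] (Fin 6 → ZMod 2), (∀ v, red2 (w v) = f (red2 v)) ∧
      ∀ x, onePlusZetaBar (f x) = f (onePlusZetaBar x) := by
  obtain ⟨f, hf⟩ := exists_linearMap_red2 hw
  refine ⟨f, hf, fun x => ?_⟩
  obtain ⟨v, rfl⟩ := red2_surjective x
  have h : w (E6zeta v) = E6zeta (w v) := congrFun hz v
  simp only [onePlusZetaBar, LinearMap.add_apply, LinearMap.id_apply, map_add]
  rw [← red2_E6zeta, ← hf (E6zeta v), h, red2_E6zeta, hf]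

/-- A subspace of `Λ/2Λ` is `W^ζ`-stable if it is preserved by every element of `W^ζ`. -/
def IsWZetaStable (S : Submodule (ZMod 2) (Fin 6 → ZMod 2)) : Prop :=
  ∀ w : Function.End (Fin 6 → ℤ), w ∈ E6Weyl → w * E6zeta = E6zeta * w →
    ∀ v : Fin 6 → ℤ, red2 v ∈ S → red2 (w v) ∈ S

theorem isWZetaStable_range : IsWZetaStable (LinearMap.range onePlusZetaBar) := by
  intro w hw hz v hv
  obtain ⟨f, hf, hc⟩ := exists_linearMap_commute hw hz
  obtain ⟨y, hy⟩ := hv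
  exact ⟨f y, by rw [hf, hc, hy]⟩

theorem isWZetaStable_ker : IsWZetaStable (LinearMap.ker onePlusZetaBar) := by
  intro w hw hz v hv
  obtain ⟨f, hf, hc⟩ := exists_linearMap_commute hw hz
  rw [LinearMap.mem_ker] at hv ⊢
  rw [hf, hc, hv, map_zero]

theorem isWZetaStable_bot : IsWZetaStable ⊥ := by
  intro w hw _ v hv
  obtain ⟨f, hf⟩ := exists_linearMap_red2 hw
  rw [Submodule.mem_bot] at hv ⊢
  rw [hf, hv, map_zero]

theorem zmod_two_eq (a : ZMod 2) : a = 0 ∨ a = 1 := by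
  revert a
  decide

theorem mem_ker_iff (x : Fin 6 → ZMod 2) :
    x ∈ LinearMap.ker onePlusZetaBar ↔ x 0 = x 5 ∧ x 2 = x 4 := by
  revert x
  simp only [LinearMap.mem_ker]
  decide

theorem mem_range_iff (x : Fin 6 → ZMod 2) :
    x ∈ LinearMap.range onePlusZetaBar ↔ x 0 = x 5 ∧ x 2 = x 4 ∧ x 1 = 0 ∧ x 3 = 0 := by
  constructor
  · rintro ⟨y, rfl⟩
    revert y
    decide
  · rintro ⟨h₀, h₂, h₁, h₃⟩
    refine ⟨x 0 • rootBar 0 + x 2 • rootBar 2, ?_⟩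
    ext j
    fin_cases j <;> simp [onePlusZetaBar, zetaBar, E6zetaPerm, Pi.single_apply, *]

theorem range_le_ker : LinearMap.range onePlusZetaBar ≤ LinearMap.ker onePlusZetaBar :=
  fun x hx => by
    rw [mem_range_iff] at hx
    exact (mem_ker_iff x).2 ⟨hx.1, hx.2.1⟩

theorem finrank_range : Module.finrank (ZMod 2) ↥(LinearMap.range onePlusZetaBar) = 2 := by
  let b : Fin 2 → Fin 6 → ZMod 2 := ![rootBar 0 + rootBar 5, rootBar 2 + rootBar 4]
  have hb : LinearIndependent (ZMod 2) b := by
    rw [Fintype.linearIndependent_iff]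
    decide
  have hspan : LinearMap.range onePlusZetaBar = Submodule.span (ZMod 2) (Set.range b) := by
    ext x
    rw [mem_range_iff, Submodule.mem_span_range_iff_exists_fun]
    revert x
    decide
  rw [hspan, finrank_span_eq_card hb, Fintype.card_fin]

theorem finrank_ker : Module.finrank (ZMod 2) ↥(LinearMap.ker onePlusZetaBar) = 4 := by
  have h := LinearMap.finrank_range_add_finrank_ker onePlusZetaBar
  rw [finrank_range, Module.finrank_fin_fun] at h
  omega

namespace IsWZetaStable

variable {S : Submodule (ZMod 2) (Fin 6 → ZMod 2)} {x : Fin 6 → ZMod 2}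

theorem reflBar_mem (hS : IsWZetaStable S) {i : Fin 6} (hi : E6zetaPerm i = i) (hx : x ∈ S) :
    reflBar i x ∈ S := by
  obtain ⟨v, rfl⟩ := red2_surjective x
  rw [← red2_E6refl]
  exact hS _ (E6refl_mem i) (by rw [E6refl_mul_E6zeta, hi]) v hx

theorem reflBar_reflBar_mem (hS : IsWZetaStable S) {i j : Fin 6} (hi : E6zetaPerm i = j)
    (hj : E6zetaPerm j = i) (h : E6Cartan i j = 0) (h' : E6Cartan j i = 0)
    (hx : x ∈ S) : reflBar i (reflBar j x) ∈ S := by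
  subst hi
  obtain ⟨v, rfl⟩ := red2_surjective x
  rw [← red2_E6refl, ← red2_E6refl]
  exact hS _ (mul_mem (E6refl_mem _) (E6refl_mem _))
    (E6refl_mul_commute_E6zeta hj (E6refl_mul_comm h h')) v hx

theorem smul_root_one (hS : IsWZetaStable S) (hx : x ∈ S) : x 3 • rootBar 1 ∈ S := by
  have h := S.sub_mem (hS.reflBar_mem (i := 1) rfl hx) hx
  convert h using 1
  clear h hx
  revert x
  decide

theorem smul_root_three (hS : IsWZetaStable S) (hx : x ∈ S) :
    (x 1 + x 2 + x 4) • rootBar 3 ∈ S := by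
  have h := S.sub_mem (hS.reflBar_mem (i := 3) rfl hx) hx
  convert h using 1
  clear h hx
  revert x
  decide

theorem smul_root_two_add (hS : IsWZetaStable S) (hx : x ∈ S) :
    (x 0 + x 3) • rootBar 2 + (x 3 + x 5) • rootBar 4 ∈ S := by
  have h := S.sub_mem
    (hS.reflBar_reflBar_mem (i := 2) (j := 4) rfl rfl rfl rfl hx) hx
  convert h using 1
  clear h hx
  revert x
  decide

theorem smul_root_zero_add (hS : IsWZetaStable S) (hx : x ∈ S) :
    x 2 • rootBar 0 + x 4 • rootBar 5 ∈ S := by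
  have h := S.sub_mem
    (hS.reflBar_reflBar_mem (i := 0) (j := 5) rfl rfl rfl rfl hx) hx
  convert h using 1
  clear h hx
  revert x
  decide

theorem root_two_add_iff (hS : IsWZetaStable S) :
    rootBar 2 + rootBar 4 ∈ S ↔ rootBar 0 + rootBar 5 ∈ S :=
  ⟨fun h => by simpa [Pi.single_apply] using hS.smul_root_zero_add h,
    fun h => by simpa [Pi.single_apply] using hS.smul_root_two_add h⟩

theorem range_le (hS : IsWZetaStable S) (h : rootBar 2 + rootBar 4 ∈ S) :
    LinearMap.range onePlusZetaBar ≤ S := by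
  intro y hy
  rw [mem_range_iff] at hy
  have hsum := S.add_mem (S.smul_mem (y 2) h) (S.smul_mem (y 0) (hS.root_two_add_iff.1 h))
  convert hsum using 1
  clear hsum
  revert y
  decide

theorem range_le_of_mem (hS : IsWZetaStable S) (hx : x ∈ S)
    (hr : x ∈ LinearMap.range onePlusZetaBar) (h0 : x ≠ 0) :
    LinearMap.range onePlusZetaBar ≤ S := by
  rw [mem_range_iff] at hr
  obtain ⟨h₀, h₂, h₁, h₃⟩ := hr
  apply hS.range_le
  rcases zmod_two_eq (x 5) with h5 | h5
  · rcases zmod_two_eq (x 4) with h4 | h4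
    · refine absurd (funext fun j => ?_) h0
      fin_cases j <;> simp [*]
    · exact hS.root_two_add_iff.2 (by simpa [h₂, h4] using hS.smul_root_zero_add hx)
  · simpa [h₀, h5, h₃] using hS.smul_root_two_add hx

theorem root_one_mem (hS : IsWZetaStable S) (h : rootBar 3 ∈ S) : rootBar 1 ∈ S := by
  simpa [Pi.single_apply] using hS.smul_root_one h

theorem root_three_mem (hS : IsWZetaStable S) (h : rootBar 1 ∈ S) : rootBar 3 ∈ S := by
  simpa [Pi.single_apply] using hS.smul_root_three h

theorem root_two_add_mem (hS : IsWZetaStable S) (h : rootBar 3 ∈ S) :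
    rootBar 2 + rootBar 4 ∈ S := by
  simpa [Pi.single_apply] using hS.smul_root_two_add h

theorem ker_le (hS : IsWZetaStable S) (h : rootBar 3 ∈ S) :
    LinearMap.ker onePlusZetaBar ≤ S := by
  intro y hy
  rw [mem_ker_iff] at hy
  have h2 := hS.root_two_add_mem h
  have hsum := S.add_mem
    (S.add_mem (S.smul_mem (y 1) (hS.root_one_mem h)) (S.smul_mem (y 3) h))
    (S.add_mem (S.smul_mem (y 2) h2) (S.smul_mem (y 0) (hS.root_two_add_iff.1 h2)))
  convert hsum using 1
  clear hsum
  revert y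
  decide

theorem ker_le_of_mem (hS : IsWZetaStable S) (hx : x ∈ S)
    (hk : x ∈ LinearMap.ker onePlusZetaBar) (hr : x ∉ LinearMap.range onePlusZetaBar) :
    LinearMap.ker onePlusZetaBar ≤ S := by
  rw [mem_ker_iff] at hk
  rw [mem_range_iff] at hr
  apply hS.ker_le
  rcases zmod_two_eq (x 3) with h3 | h3
  · rcases zmod_two_eq (x 1) with h1 | h1
    · exact absurd ⟨hk.1, hk.2, h1, h3⟩ hr
    · simpa [h1, hk.2, add_assoc, CharTwo.add_self_eq_zero] using hS.smul_root_three hx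
  · exact hS.root_three_mem (by simpa [h3] using hS.smul_root_one hx)

theorem eq_top_of_root_two (hS : IsWZetaStable S) (h : rootBar 2 ∈ S) : S = ⊤ := by
  have h3 : rootBar 3 ∈ S := by simpa [Pi.single_apply] using hS.smul_root_three h
  have h0 : rootBar 0 ∈ S := by simpa [Pi.single_apply] using hS.smul_root_zero_add h
  rw [eq_top_iff]
  intro y _
  have hk : y - (y 0 - y 5) • rootBar 0 - (y 2 - y 4) • rootBar 2 ∈ S := by
    apply hS.ker_le h3
    rw [mem_ker_iff]
    simp
  have hsum := S.add_mem (S.add_mem hk (S.smul_mem (y 2 - y 4) h)) (S.smul_mem (y 0 - y 5) h0)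
  simpa using hsum

theorem eq_top_of_root_four (hS : IsWZetaStable S) (h : rootBar 4 ∈ S) : S = ⊤ := by
  have h3 : rootBar 3 ∈ S := by simpa [Pi.single_apply] using hS.smul_root_three h
  exact hS.eq_top_of_root_two (by simpa using S.sub_mem (hS.root_two_add_mem h3) h)

theorem eq_top_of_ne (hS : IsWZetaStable S) (hx : x ∈ S) (h : x 0 ≠ x 5) : S = ⊤ := by
  have hc := hS.smul_root_two_add hx
  have hor : x 0 + x 3 = 1 ∧ x 3 + x 5 = 0 ∨ x 0 + x 3 = 0 ∧ x 3 + x 5 = 1 := by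
    revert h
    generalize x 0 = a, x 3 = b, x 5 = c
    revert a b c
    decide
  rcases hor with ⟨h₁, h₂⟩ | ⟨h₁, h₂⟩
  · exact hS.eq_top_of_root_two (by simpa [h₁, h₂] using hc)
  · exact hS.eq_top_of_root_four (by simpa [h₁, h₂] using hc)

theorem eq_top_of_mem (hS : IsWZetaStable S) (hx : x ∈ S)
    (hk : x ∉ LinearMap.ker onePlusZetaBar) : S = ⊤ := by
  rw [mem_ker_iff] at hk
  by_cases h0 : x 0 = x 5
  · exact hS.eq_top_of_ne (hS.smul_root_zero_add hx) (by
      simpa [Pi.single_apply] using fun h2 => hk ⟨h0, h2⟩)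
  · exact hS.eq_top_of_ne hx h0

end IsWZetaStable

theorem isWZetaStable_iff (S : Submodule (ZMod 2) (Fin 6 → ZMod 2)) :
    IsWZetaStable S ↔ S = ⊥ ∨ S = LinearMap.range onePlusZetaBar ∨
      S = LinearMap.ker onePlusZetaBar ∨ S = ⊤ := by
  constructor
  · intro hS
    by_cases hk : S ≤ LinearMap.ker onePlusZetaBar
    · by_cases hr : S ≤ LinearMap.range onePlusZetaBar
      · by_cases h0 : S = ⊥
        · exact .inl h0
        · obtain ⟨x, hx, hx0⟩ := S.exists_mem_ne_zero_of_ne_bot h0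
          exact .inr (.inl (hr.antisymm (hS.range_le_of_mem hx (hr hx) hx0)))
      · obtain ⟨x, hx, hxr⟩ := SetLike.not_le_iff_exists.1 hr
        exact .inr (.inr (.inl (hk.antisymm (hS.ker_le_of_mem hx (hk hx) hxr))))
    · obtain ⟨x, hx, hxk⟩ := SetLike.not_le_iff_exists.1 hk
      exact .inr (.inr (.inr (hS.eq_top_of_mem hx hxk)))
  · rintro (rfl | rfl | rfl | rfl)
    · exact isWZetaStable_bot
    · exact isWZetaStable_range
    · exact isWZetaStable_ker
    · exact fun _ _ _ _ _ => Submodule.mem_top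


/-- The 𝔽₂-subspaces of `Λ/2Λ ≅ 𝔽₂⁶` stable under the mod-2 reduction of every element of
`W^ζ` are exactly the four subspaces `0 ⊆ (1+ζ̄)(Λ/2Λ) ⊆ ker(1+ζ̄) ⊆ Λ/2Λ`, of
𝔽₂-dimensions `0, 2, 4, 6` respectively. -/
theorem wzeta_stable_subspaces :
    (∀ S : Submodule (ZMod 2) (Fin 6 → ZMod 2),
        (∀ w : Function.End (Fin 6 → ℤ), w ∈ E6Weyl → w * E6zeta = E6zeta * w →
          ∀ v : Fin 6 → ℤ, red2 v ∈ S → red2 (w v) ∈ S) ↔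
        (S = ⊥ ∨ S = LinearMap.range onePlusZetaBar ∨
          S = LinearMap.ker onePlusZetaBar ∨ S = ⊤)) ∧
    LinearMap.range onePlusZetaBar ≤ LinearMap.ker onePlusZetaBar ∧
    Module.finrank (ZMod 2) ↥(⊥ : Submodule (ZMod 2) (Fin 6 → ZMod 2)) = 0 ∧
    Module.finrank (ZMod 2) ↥(LinearMap.range onePlusZetaBar) = 2 ∧
    Module.finrank (ZMod 2) ↥(LinearMap.ker onePlusZetaBar) = 4 ∧
    Module.finrank (ZMod 2) ↥(⊤ : Submodule (ZMod 2) (Fin 6 → ZMod 2)) = 6 :=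
  ⟨isWZetaStable_iff, range_le_ker, finrank_bot _ _, finrank_range, finrank_ker,
    by rw [finrank_top, Module.finrank_fin_fun]⟩
end

section
/- Consider the binary quartic form Q(x, y) = 376x⁴ + 507x³y + 1697x²y² + 846xy³ + 119y⁴ with rational coefficients. Then: (a) Q(x, y) ≠ 0 for every (x, y) ∈ ℝ² with (x, y) ≠ (0, 0); (b) the polynomial 376X⁴ + 507X³ + 1697X² + 846X + 119 ∈ ℚ[X] is squarefree (equivalently, it has no repeated roots in an algebraic closure of ℚ). -/
open Polynomial

/-- The quartic form is a sum of squares, written so that each summand is visibly nonnegative. -/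
lemma quartic_form_eq_sum_sq (x y : ℝ) :
    376 * x ^ 4 + 507 * x ^ 3 * y + 1697 * x ^ 2 * y ^ 2 + 846 * x * y ^ 3 + 119 * y ^ 4 =
      x ^ 2 * ((752 * x + 507 * y) ^ 2 + 28711 * y ^ 2) / 1504 +
        y ^ 2 * ((423 * x + 119 * y) ^ 2 + 404 * x ^ 2) / 119 := by
  ring

lemma quartic_form_pos {x y : ℝ} (h : (x, y) ≠ (0, 0)) :
    0 < 376 * x ^ 4 + 507 * x ^ 3 * y + 1697 * x ^ 2 * y ^ 2 + 846 * x * y ^ 3 + 119 * y ^ 4 := by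
  rcases eq_or_ne x 0 with rfl | hx
  · have hy : y ≠ 0 := fun hy => h (by rw [hy])
    rw [quartic_form_eq_sum_sq]
    simp only [mul_zero, zero_add]
    positivity
  · rcases eq_or_ne y 0 with rfl | hy
    · rw [quartic_form_eq_sum_sq]
      simp only [mul_zero, add_zero]
      positivity
    · rw [quartic_form_eq_sum_sq]
      positivity

/-- Separability, by an explicit Bézout relation between the polynomial and its derivative. -/
lemma quartic_separable :
    (376 * X ^ 4 + 507 * X ^ 3 + 1697 * X ^ 2 + 846 * X + 119 : ℚ[X]).Separable := by
  have hderiv : derivative (376 * X ^ 4 + 507 * X ^ 3 + 1697 * X ^ 2 + 846 * X + 119 : ℚ[X]) =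
      1504 * X ^ 3 + 1521 * X ^ 2 + 3394 * X + 846 := by
    simp only [derivative_add, derivative_mul, derivative_ofNat, derivative_X_pow, derivative_X,
      Nat.cast_ofNat, map_ofNat]
    ring
  have hC : (C (1 / 32991066057705925 : ℚ)) * 32991066057705925 = 1 := by
    rw [← map_ofNat C, ← C_mul, ← C_1]
    norm_num
  rw [separable_def, hderiv]
  refine ⟨C (1 / 32991066057705925) *
      (5593027352894129 + 2018710988582754 * X + 2732821822171072 * X ^ 2),
    C (1 / 32991066057705925) *
      (-747729537750231 - 2877226592276001 * X - 734987033023470 * X ^ 2 -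
        683205455542768 * X ^ 3), ?_⟩
  linear_combination hC

/-- The binary quartic form `Q(x,y) = 376x⁴ + 507x³y + 1697x²y² + 846xy³ + 119y⁴`:
(a) `Q` has no nontrivial real zero; (b) the dehomogenized polynomial
`376X⁴ + 507X³ + 1697X² + 846X + 119 ∈ ℚ[X]` is squarefree. -/
theorem explicit_quartic_no_real_roots_and_squarefree :
    (∀ x y : ℝ, (x, y) ≠ (0, 0) →
      376 * x ^ 4 + 507 * x ^ 3 * y + 1697 * x ^ 2 * y ^ 2
        + 846 * x * y ^ 3 + 119 * y ^ 4 ≠ 0) ∧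
    Squarefree (376 * X ^ 4 + 507 * X ^ 3 + 1697 * X ^ 2 + 846 * X + 119 : ℚ[X]) :=
  ⟨fun _ _ h => (quartic_form_pos h).ne', quartic_separable.squarefree⟩
end
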